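/- arXiv:1703.08834 — 4 statements merged into one kernel-verified Lean document; each statement's English description precedes it below -/
import Mathlib

section
/- Let n > 1 be a natural number that is not prime. Then: (i) if n is not a prime power, every separating set of 𝒢(ℤ_n) contains 𝒮(ℤ_n); (ii) κ(𝒢(ℤ_n)) = φ(n) + 1 + κ(𝒢̃(ℤ_n)); (iii) if p_1 < p_2 < ⋯ < p_r are the prime factors of n, then ℤ̃_n = ∪_{i=1}^{r} (⟨p̄_i⟩ − {0̄}). -/
open SimpleGraph

/-- The power graph of a (multiplicative) group: distinct `x, y` are adjacent
iff one is a power of the other. -/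
def powerGraph (G : Type*) [Group G] : SimpleGraph G where
  Adj x y := x ≠ y ∧ (x ∈ Subgroup.zpowers y ∨ y ∈ Subgroup.zpowers x)
  symm := by
    constructor
    rintro x y ⟨h1, h2⟩
    exact ⟨h1.symm, h2.symm⟩
  loopless := by
    constructor
    rintro x ⟨h1, -⟩
    exact h1 rfl

/-- The power graph of the additive group `ℤ_n`. -/
def powerGraphZ (n : ℕ) : SimpleGraph (ZMod n) where
  Adj x y := x ≠ y ∧ (x ∈ AddSubgroup.zmultiples y ∨ y ∈ AddSubgroup.zmultiples x)
  symm := by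
    constructor
    rintro x y ⟨h1, h2⟩
    exact ⟨h1.symm, h2.symm⟩
  loopless := by
    constructor
    rintro x ⟨h1, -⟩
    exact h1 rfl

/-- Number of connected components of a graph. -/
noncomputable def numComponents {V : Type*} (Γ : SimpleGraph V) : ℕ :=
  Nat.card Γ.ConnectedComponent

/-- `T` is a separating set of `Γ`: deleting `T` increases the number of components. -/
def IsSepSet {V : Type*} (Γ : SimpleGraph V) (T : Set V) : Prop :=
  numComponents Γ < numComponents (Γ.induce Tᶜ)

/-- A separating set is minimal if no nonempty proper subset of it is separating. -/
def IsMinimalSepSet {V : Type*} (Γ : SimpleGraph V) (T : Set V) : Prop :=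
  IsSepSet Γ T ∧ ∀ S : Set V, S ⊆ T → S ≠ T → S.Nonempty → ¬ IsSepSet Γ S

/-- A separating set of least cardinality. -/
def IsMinimumSepSet {V : Type*} (Γ : SimpleGraph V) (T : Set V) : Prop :=
  IsSepSet Γ T ∧ ∀ S : Set V, IsSepSet Γ S → T.ncard ≤ S.ncard

/-- Vertex connectivity: the least number of vertices whose removal leaves a
disconnected or one-vertex graph. -/
noncomputable def kappa {V : Type*} (Γ : SimpleGraph V) : ℕ :=
  sInf {k | ∃ S : Set V, S.ncard = k ∧
    (¬ (Γ.induce Sᶜ).Preconnected ∨ (Sᶜ : Set V).ncard = 1)}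

/-- `𝒮(ℤ_n)`: the identity together with the generators of `ℤ_n`. -/
def genSet (n : ℕ) : Set (ZMod n) :=
  {x | AddSubgroup.zmultiples x = ⊤} ∪ {0}

/-- `ℤ̃_n = ℤ_n − 𝒮(ℤ_n)`. -/
def tildeVerts (n : ℕ) : Set (ZMod n) := (genSet n)ᶜ

/-- `𝒢̃(ℤ_n)`: the subgraph of the power graph induced on `ℤ̃_n`. -/
def tildeGraph (n : ℕ) : SimpleGraph (tildeVerts n) :=
  (powerGraphZ n).induce (tildeVerts n)

/-- The `≈`-class of `x`: elements generating the same cyclic subgroup. -/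
def simClass {G : Type*} [Group G] (x : G) : Set G :=
  {y | Subgroup.zpowers y = Subgroup.zpowers x}

/-- The `≈`-class in `ℤ_n`. -/
def simClassZ {n : ℕ} (x : ZMod n) : Set (ZMod n) :=
  {y | AddSubgroup.zmultiples y = AddSubgroup.zmultiples x}

/-- Neighbourhood of a set of vertices: vertices adjacent to some element of `A`,
excluding `A` itself. -/
def setNbhd {V : Type*} (Γ : SimpleGraph V) (A : Set V) : Set V :=
  (⋃ a ∈ A, Γ.neighborSet a) \ A

/-- The proper power graph: the power graph with the identity removed. -/
def properPowerGraph (G : Type*) [Group G] : SimpleGraph ({g : G | g ≠ 1}) :=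
  (powerGraph G).induce {g : G | g ≠ 1}

/-- Transport between nested induced subgraphs. -/
def nestIso {V : Type*} (Γ : SimpleGraph V) (D : Set V) (S : Set ↥Dᶜ) (T : Set V)
    (h : ∀ v, v ∉ T ↔ ∃ hv : v ∈ Dᶜ, (⟨v, hv⟩ : ↥Dᶜ) ∉ S) :
    ((Γ.induce Dᶜ).induce Sᶜ) ≃g (Γ.induce Tᶜ) where
  toFun x := ⟨x.1.1, (h _).2 ⟨x.1.2, x.2⟩⟩
  invFun y := ⟨⟨y.1, ((h _).1 y.2).1⟩, ((h _).1 y.2).2⟩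
  left_inv _ := rfl
  right_inv _ := rfl
  map_rel_iff' := Iff.rfl

theorem nest_card {V : Type*} [Finite V] (D : Set V) (S : Set ↥Dᶜ) (T : Set V)
    (h : ∀ v, v ∉ T ↔ ∃ hv : v ∈ Dᶜ, (⟨v, hv⟩ : ↥Dᶜ) ∉ S) :
    T.ncard = D.ncard + S.ncard ∧ Tᶜ.ncard = Sᶜ.ncard := by
  have h1 : Tᶜ = Subtype.val '' Sᶜ := by
    ext v
    simp only [Set.mem_compl_iff, h, Set.mem_image]
    constructor
    · rintro ⟨hv, hs⟩; exact ⟨⟨v, hv⟩, hs, rfl⟩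
    · rintro ⟨w, hs, rfl⟩; exact ⟨w.2, hs⟩
  have h2 : Tᶜ.ncard = Sᶜ.ncard := by
    rw [h1, Set.ncard_image_of_injective _ Subtype.val_injective]
  refine ⟨?_, h2⟩
  have a := Set.ncard_add_ncard_compl T
  have b := Set.ncard_add_ncard_compl S
  have c := Set.ncard_add_ncard_compl D
  rw [Nat.card_coe_set_eq] at b
  omega

theorem iso_pre {V W : Type*} {G : SimpleGraph V} {H : SimpleGraph W} (e : G ≃g H)
    (h : G.Preconnected) : H.Preconnected := by
  intro x y
  have := (h (e.symm x) (e.symm y)).map e.toHom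
  simpa using this

theorem dom_subset {V : Type*} (Γ : SimpleGraph V) (D T : Set V)
    (hD : ∀ d ∈ D, ∀ v, v ≠ d → Γ.Adj d v)
    (hT : ¬ (Γ.induce Tᶜ).Preconnected) : D ⊆ T := by
  intro d hd
  by_contra hdT
  apply hT
  have key : ∀ x : ↥Tᶜ, (Γ.induce Tᶜ).Reachable ⟨d, hdT⟩ x := by
    intro x
    by_cases hx : x.1 = d
    · have : x = ⟨d, hdT⟩ := Subtype.ext hx
      rw [this]
    · exact SimpleGraph.Adj.reachable (hD d hd x.1 hx)
  intro x y
  exact (key x).symm.trans (key y)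

theorem kappa_dom {V : Type*} [Finite V] (Γ : SimpleGraph V) (D : Set V)
    (hD : ∀ d ∈ D, ∀ v, v ≠ d → Γ.Adj d v) (hne : Dᶜ.Nonempty) :
    kappa Γ = D.ncard + kappa (Γ.induce Dᶜ) := by
  obtain ⟨w, hw⟩ := hne
  have hone : ∃ S : Set ↥Dᶜ, Sᶜ.ncard = 1 := ⟨{⟨w, hw⟩}ᶜ, by simp⟩
  have hone' : ∃ S : Set V, Sᶜ.ncard = 1 := ⟨{w}ᶜ, by simp⟩
  apply le_antisymm
  · obtain ⟨S, hS, h⟩ := Nat.sInf_mem (s := {k | ∃ S : Set ↥Dᶜ, S.ncard = k ∧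
      (¬ ((Γ.induce Dᶜ).induce Sᶜ).Preconnected ∨ Sᶜ.ncard = 1)})
      (by obtain ⟨S, hS⟩ := hone; exact ⟨_, S, rfl, Or.inr hS⟩)
    let T : Set V := {v | ∃ hv : v ∈ Dᶜ, (⟨v, hv⟩ : ↥Dᶜ) ∉ S}ᶜ
    have hT : ∀ v, v ∉ T ↔ ∃ hv : v ∈ Dᶜ, (⟨v, hv⟩ : ↥Dᶜ) ∉ S := fun v => by
      simp [T]
    obtain ⟨c1, c2⟩ := nest_card D S T hT
    apply Nat.sInf_le
    refine ⟨T, ?_, ?_⟩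
    · rw [c1, hS]; rfl
    · rcases h with h | h
      · left; exact fun hp => h (iso_pre (nestIso Γ D S T hT).symm hp)
      · right; rw [c2, h]
  · obtain ⟨T, hT, h⟩ := Nat.sInf_mem (s := {k | ∃ S : Set V, S.ncard = k ∧
      (¬ (Γ.induce Sᶜ).Preconnected ∨ Sᶜ.ncard = 1)})
      (by obtain ⟨S, hS⟩ := hone'; exact ⟨_, S, rfl, Or.inr hS⟩)
    change _ ≤ sInf _
    rw [← hT]
    rcases h with h | h
    · have hsub := dom_subset Γ D T hD h
      let S : Set ↥Dᶜ := Subtype.val ⁻¹' T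
      have hTS : ∀ v, v ∉ T ↔ ∃ hv : v ∈ Dᶜ, (⟨v, hv⟩ : ↥Dᶜ) ∉ S := fun v =>
        ⟨fun hv => ⟨fun hd => hv (hsub hd), hv⟩, fun ⟨_, hv⟩ => hv⟩
      obtain ⟨c1, c2⟩ := nest_card D S T hTS
      rw [c1]
      apply Nat.add_le_add_left
      exact Nat.sInf_le ⟨S, rfl, Or.inl fun hp => h (iso_pre (nestIso Γ D S T hTS) hp)⟩
    · obtain ⟨S, hS⟩ := hone
      have hk : kappa (Γ.induce Dᶜ) ≤ S.ncard := Nat.sInf_le ⟨S, rfl, Or.inr hS⟩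
      have a := Set.ncard_add_ncard_compl T
      have b := Set.ncard_add_ncard_compl S
      have c := Set.ncard_add_ncard_compl D
      rw [Nat.card_coe_set_eq] at b
      omega

theorem mem_zmul_iff {n : ℕ} (x y : ZMod n) : x ∈ AddSubgroup.zmultiples y ↔ y ∣ x := by
  rw [AddSubgroup.mem_zmultiples_iff]
  constructor
  · rintro ⟨k, rfl⟩
    exact ⟨k, by rw [zsmul_eq_mul, mul_comm]⟩
  · rintro ⟨c, rfl⟩
    obtain ⟨k, rfl⟩ := ZMod.intCast_surjective c
    exact ⟨k, by rw [zsmul_eq_mul, mul_comm]⟩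

theorem top_iff {n : ℕ} (x : ZMod n) : AddSubgroup.zmultiples x = ⊤ ↔ IsUnit x := by
  rw [isUnit_iff_dvd_one, AddSubgroup.eq_top_iff']
  simp only [mem_zmul_iff]
  exact ⟨fun h => h 1, fun h y => h.trans (one_dvd y)⟩

theorem genSet_dom (n : ℕ) : ∀ d ∈ genSet n, ∀ v, v ≠ d → (powerGraphZ n).Adj d v := by
  intro d hd v hv
  refine ⟨hv.symm, ?_⟩
  rcases hd with hd | hd
  · right
    rw [show AddSubgroup.zmultiples d = ⊤ from hd]; trivial
  · left
    rw [show d = 0 from hd]; exact zero_mem _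

theorem genSet_card (n : ℕ) (hn : 1 < n) : (genSet n).ncard = Nat.totient n + 1 := by
  haveI : NeZero n := ⟨by omega⟩
  haveI : Fact (1 < n) := ⟨hn⟩
  have h1 : {x : ZMod n | AddSubgroup.zmultiples x = ⊤} = Set.range (Units.val) := by
    ext x
    simp only [Set.mem_setOf_eq, top_iff, Set.mem_range]
    rfl
  unfold genSet
  rw [Set.union_singleton, Set.ncard_insert_of_notMem, h1, ← Set.image_univ,
    Set.ncard_image_of_injective _ Units.val_injective, Set.ncard_univ,
    Nat.card_eq_fintype_card, ZMod.card_units_eq_totient]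
  rw [h1]
  rintro ⟨u, hu⟩
  exact u.ne_zero hu

theorem part_three (n : ℕ) (hn : 1 < n) :
    tildeVerts n = ⋃ p ∈ n.primeFactors,
        ((AddSubgroup.zmultiples ((p : ZMod n)) : Set (ZMod n)) \ {0}) := by
  haveI : NeZero n := ⟨by omega⟩
  ext x
  obtain ⟨m, rfl⟩ := ZMod.natCast_zmod_surjective x
  simp only [tildeVerts, genSet, Set.mem_compl_iff, Set.mem_union, Set.mem_setOf_eq, top_iff,
    Set.mem_singleton_iff, Set.mem_iUnion, Set.mem_diff, SetLike.mem_coe, mem_zmul_iff, not_or,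
    ZMod.isUnit_iff_coprime, Nat.mem_primeFactors]
  constructor
  · rintro ⟨h1, h2⟩
    obtain ⟨p, hp, hpm, hpn⟩ := Nat.Prime.not_coprime_iff_dvd.1 h1
    exact ⟨p, ⟨hp, hpn, by omega⟩, Nat.cast_dvd_cast hpm, h2⟩
  · rintro ⟨p, ⟨hp, hpn, -⟩, hd, h2⟩
    refine ⟨fun hc => ?_, h2⟩
    have hu := isUnit_of_dvd_unit hd ((ZMod.isUnit_iff_coprime m n).2 hc)
    rw [ZMod.isUnit_iff_coprime] at hu
    exact hp.one_lt.ne' (Nat.eq_one_of_dvd_coprimes hu dvd_rfl hpn)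

theorem tilde_nonempty (n : ℕ) (hn : 1 < n) (hnp : ¬ n.Prime) : (genSet n)ᶜ.Nonempty := by
  change (tildeVerts n).Nonempty
  rw [part_three n hn]
  have hp := Nat.minFac_prime hn.ne'
  refine ⟨(n.minFac : ZMod n), Set.mem_biUnion (x := n.minFac) ?_ ⟨?_, ?_⟩⟩
  · exact Nat.mem_primeFactors.2 ⟨hp, n.minFac_dvd, by omega⟩
  · exact AddSubgroup.mem_zmultiples _
  · intro h
    have := (ZMod.natCast_eq_zero_iff _ _).1 h
    exact hnp (Nat.dvd_antisymm this n.minFac_dvd ▸ hp)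

/-- For `n > 1` not prime:
(i) if `n` is not a prime power, every separating set of `𝒢(ℤ_n)` contains `𝒮(ℤ_n)`;
(ii) `κ(𝒢(ℤ_n)) = φ(n) + 1 + κ(𝒢̃(ℤ_n))`;
(iii) `ℤ̃_n` is the union of the punctured cyclic subgroups `⟨p̄⟩ − {0̄}` over the
prime factors `p` of `n`. -/
theorem stmt1 (n : ℕ) (hn : 1 < n) (hnp : ¬ n.Prime) :
    ((¬ IsPrimePow n) → ∀ T : Set (ZMod n),
        IsSepSet (powerGraphZ n) T → genSet n ⊆ T) ∧
    (kappa (powerGraphZ n) = Nat.totient n + 1 + kappa (tildeGraph n)) ∧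
    (tildeVerts n = ⋃ p ∈ n.primeFactors,
        ((AddSubgroup.zmultiples ((p : ZMod n)) : Set (ZMod n)) \ {0})) := by
  haveI : NeZero n := ⟨by omega⟩
  refine ⟨fun _ T hT => ?_, ?_, part_three n hn⟩
  · apply dom_subset (powerGraphZ n) _ _ (genSet_dom n)
    intro hp
    have h1 : numComponents ((powerGraphZ n).induce Tᶜ) ≤ 1 := by
      have := hp.subsingleton_connectedComponent
      exact Finite.card_le_one_iff_subsingleton.2 this
    have h2 : 0 < numComponents (powerGraphZ n) := by
      haveI : Nonempty (powerGraphZ n).ConnectedComponent :=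
        ⟨(powerGraphZ n).connectedComponentMk 0⟩
      exact Nat.card_pos
    have h3 : numComponents (powerGraphZ n) < _ := hT
    omega
  · rw [kappa_dom (powerGraphZ n) (genSet n) (genSet_dom n) (tilde_nonempty n hn hnp),
      genSet_card n hn]
    rfl
end

section
/- Suppose n is not a product of two primes and n = p_1^{α_1} p_2^{α_2} ⋯ p_r^{α_r}, where r ≥ 2, p_1 < p_2 < ⋯ < p_r are primes and α_i ∈ ℕ. Then for each 1 ≤ k ≤ r, the cardinality of ∪_{i=1, i≠k}^{r} ⟨\overline{p_i p_k}⟩ (a union of cyclic subgroups of ℤ_n) equals n/p_k − p_k^{α_k −1} · φ(n/p_k^{α_k}). -/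
open SimpleGraph

theorem aux_mem (n d : ℕ) [NeZero n] (hd : d ∣ n) (x : ZMod n) :
    x ∈ AddSubgroup.zmultiples ((d : ℕ) : ZMod n) ↔ d ∣ x.val := by
  rw [AddSubgroup.mem_zmultiples_iff]
  constructor
  · rintro ⟨z, hz⟩
    have h1 : ((x.val : ℤ) : ZMod n) = ((z * d : ℤ) : ZMod n) := by
      push_cast
      rw [ZMod.natCast_zmod_val, ← hz, zsmul_eq_mul]
    rw [ZMod.intCast_eq_intCast_iff_dvd_sub] at h1
    have h2 : (d : ℤ) ∣ z * d - x.val := (Int.natCast_dvd_natCast.mpr hd).trans h1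
    have h3 : (d : ℤ) ∣ x.val := (dvd_sub_right (Dvd.intro_left z rfl)).mp h2
    exact_mod_cast h3
  · rintro ⟨c, hc⟩
    refine ⟨c, ?_⟩
    rw [← ZMod.natCast_zmod_val x, hc]
    push_cast
    rw [zsmul_eq_mul]
    push_cast
    ring

theorem aux_count (M a : ℕ) :
    ((Finset.range (a * M)).filter (fun m => M.Coprime m)).card = a * M.totient := by
  induction a with
  | zero => simp
  | succ a ih =>
    have h := Nat.filter_coprime_Ico_eq_totient M (a * M)
    have e : Finset.range ((a + 1) * M) = Finset.range (a * M) ∪ Finset.Ico (a * M) (a * M + M) := by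
      ext x
      simp only [Finset.mem_range, Finset.mem_union, Finset.mem_Ico]
      rw [add_mul, one_mul]
      omega
    rw [e, Finset.filter_union, Finset.card_union_of_disjoint, ih, h]
    · ring
    · apply Finset.disjoint_filter_filter
      rw [Finset.disjoint_left]
      intro x
      simp only [Finset.mem_range, Finset.mem_Ico]
      omega

theorem stmt5 (n : ℕ) (hn : 2 ≤ n.primeFactors.card)
    (hn2 : ¬ ∃ p q : ℕ, p.Prime ∧ q.Prime ∧ n = p * q) :
    ∀ k ∈ n.primeFactors,
      (⋃ i ∈ n.primeFactors.erase k,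
        ((AddSubgroup.zmultiples (((i * k : ℕ) : ZMod n)) : Set (ZMod n)))).ncard
      = n / k - k ^ (n.factorization k - 1) * Nat.totient (n / k ^ n.factorization k) := by
  intro k hk
  have hkp := Nat.prime_of_mem_primeFactors hk
  have hkn := Nat.dvd_of_mem_primeFactors hk
  have hn0 : n ≠ 0 := (Nat.mem_primeFactors.mp hk).2.2
  haveI : NeZero n := ⟨hn0⟩
  have ha : 0 < n.factorization k := hkp.factorization_pos_of_dvd hn0 hkn
  have hmul : k ^ n.factorization k * (n / k ^ n.factorization k) = n :=
    Nat.ordProj_mul_ordCompl_eq_self n k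
  have hcop : ¬ k ∣ n / k ^ n.factorization k := Nat.not_dvd_ordCompl hkp hn0
  generalize n.factorization k = α at *
  generalize n / k ^ α = M at *
  obtain ⟨a, rfl⟩ : ∃ a, α = a + 1 := ⟨α - 1, by omega⟩
  rw [Nat.add_sub_cancel]
  have hnk : n / k = k ^ a * M := by
    apply Nat.div_eq_of_eq_mul_right hkp.pos
    rw [← hmul]; ring
  have hkm : k * (k ^ a * M) = n := by rw [← hmul]; ring
  have hM0 : M ≠ 0 := by rintro rfl; simp at hcop
  have hset : (⋃ i ∈ n.primeFactors.erase k,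
        ((AddSubgroup.zmultiples (((i * k : ℕ) : ZMod n)) : Set (ZMod n)))) =
      ((((Finset.range (k ^ a * M)).filter (fun m => ¬ M.Coprime m)).image
        (fun m => ((k * m : ℕ) : ZMod n)) : Finset (ZMod n)) : Set (ZMod n)) := by
    have hdv : ∀ i ∈ n.primeFactors.erase k, i.Prime ∧ i ∣ M ∧ i * k ∣ n := by
      intro i hi
      rw [Finset.mem_erase, Nat.mem_primeFactors] at hi
      obtain ⟨hne, hip, hin, -⟩ := hi
      have hik : Nat.Coprime i k := (Nat.coprime_primes hip hkp).mpr hne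
      refine ⟨hip, ?_, hik.mul_dvd_of_dvd_of_dvd hin hkn⟩
      rw [← hmul] at hin
      exact (hik.pow_right _).dvd_of_dvd_mul_left hin
    ext x
    simp only [Set.mem_iUnion, SetLike.mem_coe, Finset.coe_image, Set.mem_image,
      Finset.mem_filter, Finset.mem_range, exists_prop]
    constructor
    · rintro ⟨i, hi, hx⟩
      obtain ⟨hip, hiM, hikn⟩ := hdv i hi
      rw [aux_mem n _ hikn] at hx
      obtain ⟨c, hc⟩ := hx
      refine ⟨i * c, ⟨?_, ?_⟩, ?_⟩
      · have := ZMod.val_lt x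
        rw [hc, ← hkm] at this
        refine lt_of_mul_lt_mul_left (a := k) ?_ (Nat.zero_le _)
        calc k * (i * c) = i * k * c := by ring
          _ < _ := this
      · exact Nat.not_coprime_of_dvd_of_dvd hip.one_lt hiM (Dvd.intro c rfl)
      · rw [← ZMod.natCast_zmod_val x, hc]; congr 1; ring
    · rintro ⟨m, ⟨hm, hco⟩, rfl⟩
      obtain ⟨i, hip, hiM, him⟩ := Nat.Prime.not_coprime_iff_dvd.mp hco
      have hi : i ∈ n.primeFactors.erase k := by
        rw [Finset.mem_erase, Nat.mem_primeFactors]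
        refine ⟨?_, hip, ?_, hn0⟩
        · rintro rfl; exact hcop hiM
        · rw [← hmul]; exact hiM.mul_left _
      refine ⟨i, hi, ?_⟩
      rw [aux_mem n _ (hdv i hi).2.2, ZMod.val_natCast_of_lt, mul_comm]
      · exact mul_dvd_mul_left k him
      · rw [← hkm]; exact Nat.mul_lt_mul_of_pos_left hm hkp.pos
  rw [hset, Set.ncard_coe_finset, Finset.card_image_of_injOn, hnk]
  · have h1 := aux_count M (k ^ a)
    have h2 := Finset.card_filter_add_card_filter_not (s := Finset.range (k ^ a * M))
      (fun m => M.Coprime m)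
    rw [Finset.card_range] at h2
    omega
  · intro x hx y hy hxy
    simp only [Finset.coe_filter, Finset.mem_range, Set.mem_setOf_eq] at hx hy
    have hlt : ∀ z, z < k ^ a * M → k * z < n := fun z hz => by
      rw [← hkm]; exact Nat.mul_lt_mul_of_pos_left hz hkp.pos
    have := congrArg ZMod.val hxy
    simp only at this
    rw [ZMod.val_natCast_of_lt (hlt x hx.1), ZMod.val_natCast_of_lt (hlt y hy.1)] at this
    exact Nat.eq_of_mul_eq_mul_left hkp.pos this
end

section
/- If n = p_1^{α_1} p_2^{α_2} ⋯ p_r^{α_r}, where r ≥ 2, p_1 < p_2 < ⋯ < p_r are primes and α_j ∈ ℕ for 1 ≤ j ≤ r, then κ(𝒢(ℤ_n)) ≤ φ(n) + n/p_r − p_r^{α_r −1} · φ(n/p_r^{α_r}). -/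
open SimpleGraph

theorem stmt7_count (P m c : ℕ) (hP : 0 < P) (hc : Nat.Coprime m P) :
    c * Nat.totient m ≤
      ((Finset.range (P * (c * m))).filter (fun v => P ∣ v ∧ Nat.Coprime m v)).card := by
  rcases Nat.eq_zero_or_pos m with rfl | hm
  · simp
  have h : c * Nat.totient m =
      ((Finset.range c) ×ˢ ((Finset.range m).filter (fun j => Nat.Coprime m j))).card := by
    rw [Finset.card_product, Finset.card_range, Nat.totient_eq_card_coprime]
  · rw [h]
    refine Finset.card_le_card_of_injOn (fun x => P * (x.2 + m * x.1)) ?_ ?_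
    · rintro ⟨i, j⟩ hx
      simp only [Finset.coe_product, Set.mem_prod, Finset.mem_coe, Finset.mem_range,
        Finset.mem_filter] at hx ⊢
      obtain ⟨hi, hj, hj'⟩ := hx
      refine ⟨?_, dvd_mul_right _ _, ?_⟩
      · apply Nat.mul_lt_mul_of_pos_left _ hP
        calc j + m * i < m + m * i := by omega
          _ = m * (i + 1) := by ring
          _ ≤ m * c := Nat.mul_le_mul_left _ hi
          _ = c * m := by ring
      · apply Nat.Coprime.mul_right hc
        simpa using hj'
    · rintro ⟨i, j⟩ hx ⟨i', j'⟩ hx' heq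
      simp only [Finset.coe_product, Set.mem_prod, Finset.mem_coe, Finset.mem_range,
        Finset.mem_filter] at hx hx' heq
      have e := Nat.eq_of_mul_eq_mul_left hP heq
      have e1 : j = j' := by
        have := congrArg (· % m) e
        simpa [Nat.add_mul_mod_self_left, Nat.mod_eq_of_lt hx.2.1,
          Nat.mod_eq_of_lt hx'.2.1] using this
      subst e1
      have e2 : i = i' := Nat.eq_of_mul_eq_mul_left hm (by omega)
      rw [e2]

theorem stmt7_val {n d : ℕ} [NeZero n] (hd : d ∣ n) {x y : ZMod n}
    (h : x ∈ AddSubgroup.zmultiples y) (hy : d ∣ y.val) : d ∣ x.val := by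
  obtain ⟨k, hk⟩ := AddSubgroup.mem_zmultiples_iff.1 h
  have key : ∀ z : ZMod n, d ∣ z.val ↔ ZMod.castHom hd (ZMod d) z = 0 := by
    intro z
    rw [← ZMod.natCast_eq_zero_iff]
    conv_rhs => rw [← ZMod.natCast_zmod_val z]
    rw [map_natCast]
  rw [key] at hy ⊢
  rw [← hk, map_zsmul, hy, smul_zero]

/-- If `n` has at least two distinct prime factors and `P` is its
largest prime factor (with multiplicity `α_r`), then
`κ(𝒢(ℤ_n)) ≤ φ(n) + n/P − P^{α_r − 1}·φ(n/P^{α_r})`. -/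
theorem stmt7 (n : ℕ) (hn : 2 ≤ n.primeFactors.card)
    (P : ℕ) (hP : P ∈ n.primeFactors) (hPmax : ∀ q ∈ n.primeFactors, q ≤ P) :
    kappa (powerGraphZ n) ≤
      Nat.totient n + n / P
        - P ^ (n.factorization P - 1) * Nat.totient (n / P ^ n.factorization P) := by
  classical
  have hPp := Nat.prime_of_mem_primeFactors hP
  have hPn := Nat.dvd_of_mem_primeFactors hP
  have hn0 : n ≠ 0 := by rintro rfl; simp at hP
  haveI : NeZero n := ⟨hn0⟩
  obtain ⟨q, hq, hqP⟩ := Finset.exists_mem_ne (by omega : 1 < n.primeFactors.card) P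
  have hqp := Nat.prime_of_mem_primeFactors hq
  have hqn := Nat.dvd_of_mem_primeFactors hq
  have hPq : ¬ P ∣ q := fun h => hqP ((Nat.prime_dvd_prime_iff_eq hPp hqp).1 h).symm
  set a := n.factorization P with ha
  have ha1 : 1 ≤ a := hPp.factorization_pos_of_dvd hn0 hPn
  set m := n / P ^ a with hm
  set c := P ^ (a - 1) with hc
  have hPc : P ^ a = P * c := by
    rw [hc, ← pow_succ']; congr 1; omega
  have hnm : P ^ a * m = n := Nat.ordProj_mul_ordCompl_eq_self n P
  have hnf : n = P * (c * m) := by rw [← hnm, hPc]; ring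
  have hmP : Nat.Coprime m P := (Nat.coprime_ordCompl hPp hn0).symm
  have hmn : m ∣ n := ⟨P ^ a, by rw [mul_comm]; exact hnm.symm⟩
  have hcop : ∀ v, Nat.Coprime m v → ¬ P ∣ v → Nat.Coprime n v := by
    intro v h1 h2
    rw [← hnm]
    exact Nat.Coprime.mul_left (((Nat.Prime.coprime_iff_not_dvd hPp).2 h2).pow_left a) h1
  set AN := (Finset.range n).filter (fun v => P ∣ v ∧ Nat.Coprime m v) with hAN
  set TN := (Finset.range n).filter
    (fun v => Nat.Coprime n v ∨ (P ∣ v ∧ ¬ Nat.Coprime m v)) with hTN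
  have hA : c * Nat.totient m ≤ AN.card := by
    have := stmt7_count P m c hPp.pos hmP
    rwa [← hnf] at this
  have hdisj : Disjoint TN AN := by
    rw [Finset.disjoint_left]
    intro v hv hv'
    simp only [hTN, hAN, Finset.mem_filter] at hv hv'
    rcases hv.2 with h | h
    · exact Nat.not_coprime_of_dvd_of_dvd hPp.one_lt hPn hv'.2.1 h
    · exact h.2 hv'.2.2
  have hcard : TN.card + AN.card ≤ Nat.totient n + n / P := by
    rw [← Finset.card_union_of_disjoint hdisj]
    calc (TN ∪ AN).card ≤ ((Finset.range n).filter (fun v => Nat.Coprime n v) ∪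
          (Finset.range (n / P)).image (fun w => P * w)).card := by
            apply Finset.card_le_card
            have key : ∀ v, v < n → P ∣ v → ∃ w < n / P, P * w = v := by
              rintro v hv ⟨w, rfl⟩
              refine ⟨w, ?_, rfl⟩
              rw [Nat.lt_div_iff_mul_lt' hPn]
              exact hv
            intro v hv
            simp only [hTN, hAN, Finset.mem_union, Finset.mem_filter, Finset.mem_range,
              Finset.mem_image] at hv ⊢
            rcases hv with ⟨h0, h | h⟩ | ⟨h0, h⟩
            · exact Or.inl ⟨h0, h⟩
            · exact Or.inr (key v h0 h.1)
            · exact Or.inr (key v h0 h.1)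
      _ ≤ _ := Finset.card_union_le _ _
      _ ≤ _ := by
        rw [Nat.totient_eq_card_coprime]
        refine Nat.add_le_add_left ?_ _
        exact Finset.card_image_le.trans (by simp)
  let T : Set (ZMod n) := {x | x.val ∈ TN}
  have hT : T.ncard ≤ TN.card := by
    rw [← Set.ncard_coe_finset TN]
    exact Set.ncard_le_ncard_of_injOn ZMod.val (fun x hx => hx)
      (fun x _ y _ h => ZMod.val_injective n h) (Finset.finite_toSet _)
  have hTmem : ∀ x : ZMod n, x ∈ T ↔
      (Nat.Coprime n x.val ∨ (P ∣ x.val ∧ ¬ Nat.Coprime m x.val)) := by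
    intro x
    simp [T, hTN, ZMod.val_lt]
  refine le_trans (Nat.sInf_le (m := T.ncard) ⟨T, rfl, Or.inl ?_⟩) (by omega)
  intro hpre
  have hstep : ∀ u v : (Tᶜ : Set (ZMod n)), ((powerGraphZ n).induce Tᶜ).Reachable u v →
      P ∣ (u : ZMod n).val → P ∣ (v : ZMod n).val := by
    have hadj : ∀ u v : (Tᶜ : Set (ZMod n)), ((powerGraphZ n).induce Tᶜ).Adj u v →
      P ∣ (u : ZMod n).val → P ∣ (v : ZMod n).val := by
      intro u v h hu
      have h' : (powerGraphZ n).Adj u v := h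
      rcases h'.2 with h2 | h2
      · by_contra hv
        have hu' := (not_congr (hTmem u)).1 u.2
        have hv' := (not_congr (hTmem v)).1 v.2
        push Not at hu' hv'
        apply hv'.1
        apply hcop _ _ hv
        have hmu := hu'.2 hu
        have hg : Nat.gcd m (v : ZMod n).val ∣ (u : ZMod n).val :=
          stmt7_val ((Nat.gcd_dvd_left _ _).trans hmn) h2 (Nat.gcd_dvd_right _ _)
        exact Nat.eq_one_of_dvd_coprimes hmu (Nat.gcd_dvd_left _ _) hg
      · exact stmt7_val hPn h2 hu
    rintro u v ⟨w⟩
    induction w with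
    | nil => exact id
    | cons h _ ih => exact fun hu => ih (hadj _ _ h hu)
  have hPqn : P * q ∣ n := Nat.Coprime.mul_dvd_of_dvd_of_dvd
    ((Nat.coprime_primes hPp hqp).2 (Ne.symm hqP)) hPn hqn
  have hle := Nat.le_of_dvd (Nat.pos_of_ne_zero hn0) hPqn
  have h2P := hPp.two_le
  have h2q := hqp.two_le
  have hvP : ((P : ℕ) : ZMod n).val = P := ZMod.val_cast_of_lt (by nlinarith)
  have hvq : ((q : ℕ) : ZMod n).val = q := ZMod.val_cast_of_lt (by nlinarith)
  have hPT : ((P : ℕ) : ZMod n) ∈ Tᶜ := by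
    rw [Set.mem_compl_iff, hTmem, hvP]
    rintro (h | h)
    · exact Nat.not_coprime_of_dvd_of_dvd hPp.one_lt hPn dvd_rfl h
    · exact h.2 hmP
  have hqT : ((q : ℕ) : ZMod n) ∈ Tᶜ := by
    rw [Set.mem_compl_iff, hTmem, hvq]
    rintro (h | h)
    · exact Nat.not_coprime_of_dvd_of_dvd hqp.one_lt hqn dvd_rfl h
    · exact hPq h.1
  have := hstep ⟨_, hPT⟩ ⟨_, hqT⟩ (hpre _ _) (by simp only [hvP]; exact dvd_rfl)
  simp only [hvq] at this
  exact hPq this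
end

section
/- Suppose n ∈ ℕ is not a product of two primes and n = p_1^{α_1} p_2^{α_2} ⋯ p_r^{α_r}, where r ≥ 2, p_1 < p_2 < ⋯ < p_r are primes and α_i ∈ ℕ. Then for each 1 ≤ k ≤ r, the set Ñ([\overline{p_k^{α_k}}]) is a minimal separating set of 𝒢̃(ℤ_n). -/
open SimpleGraph

def gg {n : ℕ} (x : ZMod n) : ℕ := Nat.gcd x.val n

theorem gg_dvd {n : ℕ} (x : ZMod n) : gg x ∣ n := Nat.gcd_dvd_right _ _

theorem gg_cast {n d : ℕ} (h : d ∣ n) : gg ((d : ℕ) : ZMod n) = d := by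
  unfold gg
  rw [ZMod.val_natCast, ← Nat.gcd_rec, Nat.gcd_comm]
  exact Nat.gcd_eq_left h

theorem mem_zm {n : ℕ} [NeZero n] (x y : ZMod n) :
    x ∈ AddSubgroup.zmultiples y ↔ gg y ∣ gg x := by
  rw [AddSubgroup.mem_zmultiples_iff]
  constructor
  · rintro ⟨k, rfl⟩
    refine Nat.dvd_gcd ?_ (gg_dvd y)
    have h1 : ((gg y : ℕ) : ℤ) ∣ (y.val : ℤ) := by
      exact_mod_cast Nat.gcd_dvd_left _ _
    have h2 : ((gg y : ℕ) : ℤ) ∣ (n : ℤ) := by exact_mod_cast gg_dvd y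
    have h3 : (((k • y).val : ℤ) : ZMod n) = ((k * y.val : ℤ) : ZMod n) := by
      push_cast
      simp
    rw [ZMod.intCast_eq_intCast_iff_dvd_sub] at h3
    have h4 := dvd_trans h2 h3
    have h5 := (dvd_sub_right (h1.mul_left k)).1 h4
    exact_mod_cast h5
  · intro h
    have hx : gg y ∣ x.val := h.trans (Nat.gcd_dvd_left _ _)
    obtain ⟨c, hc⟩ := hx
    have hb := Nat.gcd_eq_gcd_ab y.val n
    refine ⟨Nat.gcdA y.val n * c, ?_⟩
    have h1 : x = ((x.val : ℕ) : ZMod n) := by simp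
    have h2 : ((gg y : ℕ) : ZMod n) = y * (Nat.gcdA y.val n : ZMod n) := by
      have := congrArg (Int.cast : ℤ → ZMod n) hb
      push_cast at this
      simpa [gg] using this
    rw [h1, hc]
    push_cast
    rw [h2, zsmul_eq_mul]
    push_cast
    ring

theorem zm_eq {n : ℕ} [NeZero n] (x y : ZMod n) :
    AddSubgroup.zmultiples x = AddSubgroup.zmultiples y ↔ gg x = gg y := by
  constructor
  · intro h
    apply Nat.dvd_antisymm
    · rw [← mem_zm, h]; exact AddSubgroup.mem_zmultiples y
    · rw [← mem_zm, ← h]; exact AddSubgroup.mem_zmultiples x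
  · intro h
    ext z
    rw [mem_zm, mem_zm, h]

theorem mem_tilde {n : ℕ} [NeZero n] (x : ZMod n) :
    x ∈ tildeVerts n ↔ gg x ≠ 1 ∧ gg x ≠ n := by
  have h1 : AddSubgroup.zmultiples x = ⊤ ↔ gg x = 1 := by
    constructor
    · intro h
      have : ((1 : ℕ) : ZMod n) ∈ AddSubgroup.zmultiples x := by rw [h]; trivial
      rw [mem_zm, gg_cast (one_dvd n)] at this
      exact Nat.dvd_one.1 this
    · intro h
      ext z
      rw [mem_zm, h]
      simp
  have h2 : x = 0 ↔ gg x = n := by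
    constructor
    · rintro rfl
      simp [gg]
    · intro h
      have : n ∣ x.val := by
        conv_lhs => rw [← h]
        exact Nat.gcd_dvd_left _ _
      have := Nat.eq_zero_of_dvd_of_lt this (ZMod.val_lt x)
      exact (ZMod.val_eq_zero x).1 this
  simp only [tildeVerts, genSet, Set.mem_compl_iff, Set.mem_union, Set.mem_ofPred_eq,
    Set.mem_singleton_iff, h1, h2, not_or]

def TT (n q : ℕ) : Set (tildeVerts n) :=
  {x | gg x.1 ≠ q ∧ (gg x.1 ∣ q ∨ q ∣ gg x.1)}

theorem TT_eq (n q : ℕ) [NeZero n] (hq : q ∣ n) :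
    (Subtype.val ⁻¹' (setNbhd (powerGraphZ n) (simClassZ ((q : ℕ) : ZMod n)) \ genSet n)
      : Set (tildeVerts n)) = TT n q := by
  ext ⟨x, hx⟩
  have hx' : x ∉ genSet n := hx
  simp only [Set.mem_preimage, Set.mem_sdiff, hx', not_false_eq_true, and_true, setNbhd, TT,
    Set.mem_iUnion, SimpleGraph.mem_neighborSet, simClassZ, Set.mem_ofPred_eq, zm_eq, gg_cast hq,
    powerGraphZ, mem_zm]
  constructor
  · rintro ⟨⟨a, ha, hne, h⟩, h2⟩
    rw [ha] at h
    exact ⟨h2, h⟩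
  · rintro ⟨h2, h⟩
    refine ⟨⟨(q : ℕ), gg_cast hq, ?_, ?_⟩, h2⟩
    · rintro rfl
      exact h2 (gg_cast hq)
    · rw [gg_cast hq]; exact h

theorem reach {n : ℕ} [NeZero n] (S : Set (tildeVerts n)) (u v : (Sᶜ : Set (tildeVerts n)))
    (h : gg u.1.1 ∣ gg v.1.1) : ((tildeGraph n).induce Sᶜ).Reachable u v := by
  by_cases e : u = v
  · rw [e]
  · apply SimpleGraph.Adj.reachable
    refine ⟨fun h' => e (Subtype.ext (Subtype.ext h')), Or.inr ?_⟩
    exact (mem_zm _ _).2 h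

theorem mkv {n q : ℕ} [NeZero n] {S : Set (tildeVerts n)} (hS : S ⊆ TT n q) (e : ℕ)
    (hq : q ∣ n) (he : e ∣ n) (h1 : ¬ e ∣ q) (h2 : ¬ q ∣ e) :
    ∃ u : (Sᶜ : Set (tildeVerts n)), gg u.1.1 = e := by
  have ht : ((e : ℕ) : ZMod n) ∈ tildeVerts n := by
    rw [mem_tilde, gg_cast he]
    exact ⟨fun h => h1 (h ▸ one_dvd q), fun h => h2 (h ▸ hq)⟩
  refine ⟨⟨⟨_, ht⟩, fun h => ?_⟩, gg_cast he⟩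
  have := (hS h).2
  simp only [gg_cast he] at this
  tauto

theorem precon {n q m : ℕ} [NeZero n] (hn : n = q * m) (hc : Nat.Coprime q m) (hq1 : q ≠ 1)
    (hm1 : m ≠ 1) (S : Set (tildeVerts n)) (hS : S ⊆ TT n q) (x0 : tildeVerts n)
    (hx0 : x0 ∈ TT n q) (hx0S : x0 ∉ S) : ((tildeGraph n).induce Sᶜ).Preconnected := by
  have hqn : q ∣ n := ⟨m, hn⟩
  have hmn : m ∣ n := ⟨q, by rw [hn, mul_comm]⟩
  have key : ∀ f, f ∣ m → f ≠ 1 → ¬ f ∣ q := fun f h1 h2 h3 =>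
    h2 (Nat.dvd_one.1 (hc ▸ Nat.dvd_gcd h3 h1))
  have key2 : ∀ f, f ∣ m → ¬ q ∣ f := fun f h1 h2 =>
    hq1 (Nat.dvd_one.1 (hc ▸ Nat.dvd_gcd dvd_rfl (h2.trans h1)))
  obtain ⟨M, hM⟩ := mkv hS m hqn hmn (key m dvd_rfl hm1) (key2 m dvd_rfl)
  have hA : ∀ v : (Sᶜ : Set (tildeVerts n)), ¬ q ∣ gg v.1.1 →
      ((tildeGraph n).induce Sᶜ).Reachable v M := by
    intro v hv
    obtain ⟨L, hL⟩ := mkv hS (Nat.lcm (gg v.1.1) m) hqn (Nat.lcm_dvd (gg_dvd _) hmn)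
      (fun h => key m dvd_rfl hm1 ((Nat.dvd_lcm_right _ _).trans h))
      (fun h => hv (hc.dvd_of_dvd_mul_right (h.trans (Nat.lcm_dvd_mul _ _))))
    refine (reach S v L ?_).trans (reach S M L ?_).symm
    · rw [hL]; exact Nat.dvd_lcm_left _ _
    · rw [hL, hM]; exact Nat.dvd_lcm_right _ _
  have hB : ∀ v : (Sᶜ : Set (tildeVerts n)), gg v.1.1 ≠ q →
      ((tildeGraph n).induce Sᶜ).Reachable v M := by
    intro v hv
    by_cases h : q ∣ gg v.1.1
    · obtain ⟨f, hf⟩ := h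
      have hq0 : 0 < q := Nat.pos_of_ne_zero (by rintro rfl; simp at hn; exact NeZero.ne n hn)
      have hfm : f ∣ m := by
        have := gg_dvd v.1.1
        rw [hf, hn] at this
        exact (Nat.mul_dvd_mul_iff_left hq0).1 this
      have hf1 : f ≠ 1 := by rintro rfl; simp at hf; exact hv hf
      obtain ⟨F, hF⟩ := mkv hS f hqn (hfm.trans hmn) (key f hfm hf1) (key2 f hfm)
      refine (reach S F v ?_).symm.trans (reach S F M ?_)
      · rw [hF, hf]; exact Dvd.intro_left _ rfl
      · rw [hF, hM]; exact hfm
    · exact hA v h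
  have hC : ∀ v : (Sᶜ : Set (tildeVerts n)), ((tildeGraph n).induce Sᶜ).Reachable v M := by
    intro v
    by_cases hv : gg v.1.1 = q
    · let X : (Sᶜ : Set (tildeVerts n)) := ⟨x0, hx0S⟩
      refine SimpleGraph.Reachable.trans ?_ (hB X hx0.1)
      rcases hx0.2 with h | h
      · exact (reach S X v (by rw [hv]; exact h)).symm
      · exact reach S v X (by rw [hv]; exact h)
    · exact hB v hv
  exact fun u v => (hC u).trans (hC v).symm

theorem stays {n q : ℕ} [NeZero n] {u v : ((TT n q)ᶜ : Set (tildeVerts n))}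
    (w : ((tildeGraph n).induce (TT n q)ᶜ).Walk u v) : gg u.1.1 = q → gg v.1.1 = q := by
  induction w with
  | nil => exact id
  | @cons a b c h _ ih =>
    intro ha
    apply ih
    have h' : a.1.1 ≠ b.1.1 ∧ (a.1.1 ∈ AddSubgroup.zmultiples b.1.1 ∨
      b.1.1 ∈ AddSubgroup.zmultiples a.1.1) := h
    rw [mem_zm, mem_zm, ha] at h'
    by_contra hb
    exact b.2 ⟨hb, h'.2⟩

theorem nc_le {V : Type*} (G : SimpleGraph V) (h : G.Preconnected) : numComponents G ≤ 1 := by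
  have := h.subsingleton_connectedComponent
  exact Finite.card_le_one_iff_subsingleton.2 this

theorem nc_pos {V : Type*} [Finite V] (G : SimpleGraph V) (v : V) : 1 ≤ numComponents G := by
  have : Nonempty G.ConnectedComponent := ⟨G.connectedComponentMk v⟩
  exact Nat.card_pos

theorem nonempty_TT {n q m k a : ℕ} [NeZero n] (hn : n = q * m) (hc : Nat.Coprime q m)
    (hk : k.Prime) (hq : q = k ^ a) (ha : a ≠ 0) (hm1 : m ≠ 1)
    (hn2 : ¬ ∃ p q : ℕ, p.Prime ∧ q.Prime ∧ n = p * q) : (TT n q).Nonempty := by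
  have hn0 := NeZero.ne n
  have hq0 : q ≠ 0 := by rintro rfl; simp at hn; exact hn0 hn
  have hm0 : m ≠ 0 := by rintro rfl; simp at hn; exact hn0 hn
  have hkq : k ∣ q := hq ▸ dvd_pow_self k ha
  have mk : ∀ e, e ∣ n → e ≠ 1 → e ≠ n → e ≠ q → (e ∣ q ∨ q ∣ e) → (TT n q).Nonempty := by
    intro e h h1 h2 h3 h4
    refine ⟨⟨(e : ℕ), (mem_tilde _).2 ?_⟩, ?_⟩
    · rw [gg_cast h]; exact ⟨h1, h2⟩
    · change gg _ ≠ q ∧ (gg _ ∣ q ∨ q ∣ gg _)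
      rw [gg_cast h]; exact ⟨h3, h4⟩
  by_cases hkk : k = q
  · have hmp : ¬ m.Prime := fun h => hn2 ⟨q, m, hkk ▸ hk, h, hn⟩
    have hf := Nat.minFac_prime hm1
    have hfd := Nat.minFac_dvd m
    have hfm : m.minFac ≠ m := fun h => hmp (h ▸ hf)
    refine mk (q * m.minFac) (hn ▸ Nat.mul_dvd_mul_left q hfd) ?_ ?_ ?_ (Or.inr ⟨_, rfl⟩)
    · intro h; exact hf.one_lt.ne' (Nat.eq_one_of_mul_eq_one_left h)
    · intro h; rw [hn] at h
      exact hfm (Nat.eq_of_mul_eq_mul_left (Nat.pos_of_ne_zero hq0) h)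
    · intro h
      exact hf.one_lt.ne' (Nat.eq_of_mul_eq_mul_left (Nat.pos_of_ne_zero hq0) (by simpa using h))
  · refine mk k (hkq.trans ⟨m, hn⟩) hk.one_lt.ne' ?_ hkk (Or.inl hkq)
    rintro rfl
    exact hkk (Nat.dvd_antisymm hkq ⟨m, hn⟩)

/-- If `n` has at least two prime factors and is not a product of two
primes, then for each prime factor `k` of `n` (with multiplicity `α_k`), the set
`Ñ([\overline{k^{α_k}}])` is a minimal separating set of `𝒢̃(ℤ_n)`. -/
theorem stmt10 (n : ℕ) (hn : 2 ≤ n.primeFactors.card)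
    (hn2 : ¬ ∃ p q : ℕ, p.Prime ∧ q.Prime ∧ n = p * q) :
    ∀ k ∈ n.primeFactors,
      IsMinimalSepSet (tildeGraph n)
        (Subtype.val ⁻¹'
          (setNbhd (powerGraphZ n)
            (simClassZ (((k ^ n.factorization k : ℕ) : ZMod n))) \ genSet n)) := by
  intro k hk
  have hn0 : n ≠ 0 := by rintro rfl; simp at hn
  have : NeZero n := ⟨hn0⟩
  have hkp := Nat.prime_of_mem_primeFactors hk
  have hkd := Nat.dvd_of_mem_primeFactors hk
  have ha : n.factorization k ≠ 0 := (hkp.factorization_pos_of_dvd hn0 hkd).ne'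
  obtain ⟨q, hq⟩ : ∃ q, q = k ^ n.factorization k := ⟨_, rfl⟩
  obtain ⟨m, hm⟩ : q ∣ n := hq ▸ Nat.ordProj_dvd n k
  have hc : Nat.Coprime q m := by
    have h1 := Nat.coprime_ordCompl hkp hn0
    have : n / k ^ n.factorization k = m := by
      rw [← hq]
      refine Nat.div_eq_of_eq_mul_right (Nat.pos_of_ne_zero ?_) hm
      rintro rfl; simp at hm; exact hn0 hm
    rw [this] at h1
    rw [hq]
    exact h1.pow_left _
  have hq1 : q ≠ 1 := by
    rw [hq]; exact (Nat.one_lt_pow ha hkp.one_lt).ne'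
  have hm1 : m ≠ 1 := by
    rintro rfl
    rw [mul_one] at hm
    have h3 := Nat.primeFactors_prime_pow ha hkp
    rw [← hq, ← hm] at h3
    rw [h3] at hn
    simp at hn
  have hqn : q ∣ n := ⟨m, hm⟩
  rw [← hq, TT_eq n q hqn]
  obtain ⟨x0, hx0⟩ := nonempty_TT hm hc hkp hq ha hm1 hn2
  have hpre : (tildeGraph n).Preconnected := by
    have h := precon hm hc hq1 hm1 ∅ (Set.empty_subset _) x0 hx0 (Set.notMem_empty _)
    intro u v
    exact (h ⟨u, Set.notMem_empty u⟩ ⟨v, Set.notMem_empty v⟩).map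
      (SimpleGraph.Embedding.induce _).toHom
  have hmn : m ∣ n := ⟨q, by rw [hm, mul_comm]⟩
  have hmq : ¬ m ∣ q := fun h => hm1 (Nat.dvd_one.1 (hc ▸ Nat.dvd_gcd h dvd_rfl))
  have hqm : ¬ q ∣ m := fun h => hq1 (Nat.dvd_one.1 (hc ▸ Nat.dvd_gcd dvd_rfl h))
  constructor
  · refine lt_of_le_of_lt (nc_le _ hpre) ?_
    obtain ⟨M, hM⟩ := mkv (S := TT n q) (le_refl _) m hqn hmn hmq hqm
    have hQ : ((q : ℕ) : ZMod n) ∈ tildeVerts n := by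
      rw [mem_tilde, gg_cast hqn]
      exact ⟨hq1, fun h => hmq (by rw [h]; exact hmn)⟩
    let Q : ((TT n q)ᶜ : Set (tildeVerts n)) := ⟨⟨_, hQ⟩, fun h => h.1 (gg_cast hqn)⟩
    have hne : ((tildeGraph n).induce (TT n q)ᶜ).connectedComponentMk Q ≠
        ((tildeGraph n).induce (TT n q)ᶜ).connectedComponentMk M := by
      intro h
      obtain ⟨w⟩ := SimpleGraph.ConnectedComponent.exact h
      have := stays w (gg_cast hqn)
      rw [hM] at this
      exact hqm (this ▸ dvd_rfl)
    have : Nontrivial ((tildeGraph n).induce (TT n q)ᶜ).ConnectedComponent := ⟨_, _, hne⟩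
    exact Finite.one_lt_card
  · intro S hS hST _ hsep
    obtain ⟨x, hx, hxS⟩ := Set.exists_of_ssubset (hS.ssubset_of_ne hST)
    have h1 := nc_le _ (precon hm hc hq1 hm1 S hS x hx hxS)
    have h2 := nc_pos (tildeGraph n) x
    unfold IsSepSet at hsep
    omega
end
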